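/- arXiv:2112.07251 — 3 statements merged into one kernel-verified Lean document; each statement's English description precedes it below -/
import Mathlib

section
/- (Quantitative implicit function theorem.) Let X, Y, Z be Banach spaces, U⊂X and V⊂Y neighborhoods of x₀ and y₀ respectively, and let Ψ∈C¹(U×V, Z). Fix s, δ > 0 and set X_s := {x∈X : ‖x−x₀‖_X < s}, Y_δ := {y∈Y : ‖y−y₀‖_Y < δ}, and assume the closures of X_s and Y_δ are contained in U and V respectively. Suppose Ψ(x₀,y₀)=0 and that the partial derivative D_yΨ(x₀,y₀)∈L(Y,Z) is invertible. If sup_{x∈cl(X_s)} ‖Ψ(x,y₀)‖_Z ≤ δ/(2‖D_yΨ(x₀,y₀)^{-1}‖_{L(Z,Y)}) and sup_{(x,y)∈cl(X_s)×cl(Y_δ)} ‖Id_Y − D_yΨ(x₀,y₀)^{-1} D_yΨ(x,y)‖_{L(Y,Y)} ≤ 1/2, then there exists y∈C¹(X_s, cl(Y_δ)) such that Ψ(x, y(x)) = 0 for all x∈X_s. -/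
open Asymptotics Filter Topology

/-- A function with values in the zero set of `F` which satisfies a Lipschitz bound at `x` is
differentiable at `x`, provided the partial derivative of `F` in the second variable is invertible.
The derivative of `F` need only be taken within a set containing the graph of `f`. -/
theorem HasFDerivWithinAt.hasFDerivAt_implicit
    {X Y Z : Type*} [NormedAddCommGroup X] [NormedSpace ℝ X]
    [NormedAddCommGroup Y] [NormedSpace ℝ Y] [NormedAddCommGroup Z] [NormedSpace ℝ Z]
    {F : X × Y → Z} {F' : X × Y →L[ℝ] Z} {S : Set (X × Y)} {f : X → Y} {x : X}
    (hF : HasFDerivWithinAt F F' S (x, f x))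
    (hinv : (F'.comp (ContinuousLinearMap.inr ℝ X Y)).IsInvertible)
    (hS : ∀ᶠ x' in 𝓝 x, (x', f x') ∈ S) (h0 : ∀ᶠ x' in 𝓝 x, F (x', f x') = F (x, f x))
    (hO : (fun x' => f x' - f x) =O[𝓝 x] fun x' => x' - x) :
    HasFDerivAt f (-((F'.comp (ContinuousLinearMap.inr ℝ X Y)).inverse.comp
      (F'.comp (ContinuousLinearMap.inl ℝ X Y)))) x := by
  obtain ⟨e, he⟩ := hinv
  have hcont : Tendsto f (𝓝 x) (𝓝 (f x)) := by
    have h : Tendsto (fun x' => f x' - f x) (𝓝 x) (𝓝 0) := by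
      refine hO.trans_tendsto ?_
      simpa using (tendsto_id (α := X) (x := 𝓝 x)).sub_const x
    simpa using h.add_const (f x)
  have hgraph : Tendsto (fun x' => (x', f x')) (𝓝 x) (𝓝[S] (x, f x)) :=
    tendsto_nhdsWithin_iff.2 ⟨tendsto_id.prodMk_nhds hcont, hS⟩
  have ho := hF.isLittleO.comp_tendsto hgraph
  have hO' : (fun x' => ((x', f x') : X × Y) - (x, f x)) =O[𝓝 x] fun x' => x' - x :=
    (isBigO_refl _ _).prod_left hO
  have ho' := ho.trans_isBigO hO'
  rw [hasFDerivAt_iff_isLittleO]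
  refine (((e.symm : Z →L[ℝ] Y).isBigO_comp _ _).trans_isLittleO ho').neg_left.congr' ?_ .rfl
  filter_upwards [h0] with x' hx'
  have hsplit : F' (x' - x, f x' - f x) = F' (x' - x, 0) + e (f x' - f x) := by
    have : e (f x' - f x) = F' (0, f x' - f x) := by
      simpa using DFunLike.congr_fun he (f x' - f x)
    rw [this, ← map_add]
    simp
  simp [-map_sub, ← he, hx', hsplit, add_comm]

/-- Quantitative implicit function theorem, Theorem A.1. -/
theorem quantitative_implicit_function_theorem
    {X Y Z : Type*} [NormedAddCommGroup X] [NormedSpace ℝ X] [CompleteSpace X]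
    [NormedAddCommGroup Y] [NormedSpace ℝ Y] [CompleteSpace Y]
    [NormedAddCommGroup Z] [NormedSpace ℝ Z] [CompleteSpace Z]
    (U : Set X) (V : Set Y) (x₀ : X) (y₀ : Y) (hU : U ∈ nhds x₀) (hV : V ∈ nhds y₀)
    (Ψ : X → Y → Z) (hΨ : ContDiffOn ℝ 1 (fun p : X × Y => Ψ p.1 p.2) (U ×ˢ V))
    (s δ : ℝ) (hs : 0 < s) (hδ : 0 < δ)
    (hXs : closure (Metric.ball x₀ s) ⊆ U) (hYδ : closure (Metric.ball y₀ δ) ⊆ V)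
    (hΨ0 : Ψ x₀ y₀ = 0)
    -- `D_yΨ(x₀,y₀)` is invertible, with inverse `T.symm`:
    (T : Y ≃L[ℝ] Z) (hT : (T : Y →L[ℝ] Z) = fderiv ℝ (Ψ x₀) y₀)
    (h1 : ∀ x ∈ closure (Metric.ball x₀ s),
        ‖Ψ x y₀‖ ≤ δ / (2 * ‖(T.symm : Z →L[ℝ] Y)‖))
    (h2 : ∀ x ∈ closure (Metric.ball x₀ s), ∀ y ∈ closure (Metric.ball y₀ δ),
        ‖ContinuousLinearMap.id ℝ Y
            - (T.symm : Z →L[ℝ] Y).comp (fderiv ℝ (Ψ x) y)‖ ≤ 1 / 2) :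
    ∃ y : X → Y, ContDiffOn ℝ 1 y (Metric.ball x₀ s) ∧
      ∀ x ∈ Metric.ball x₀ s, y x ∈ closure (Metric.ball y₀ δ) ∧ Ψ x (y x) = 0 := by
  rcases subsingleton_or_nontrivial Y with hY | hY
  · have := T.symm.injective.subsingleton
    exact ⟨fun _ => y₀, contDiffOn_const, fun x _ =>
      ⟨subset_closure (Metric.mem_ball_self hδ), Subsingleton.elim _ _⟩⟩
  set B := Metric.ball x₀ s
  set K := closure (Metric.ball y₀ δ)
  set F : X × Y → Z := fun p => Ψ p.1 p.2
  have hKball : K = Metric.closedBall y₀ δ := closure_ball y₀ hδ.ne'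
  have hKconv : Convex ℝ K := (convex_ball y₀ δ).closure
  have hKuniq : UniqueDiffOn ℝ K :=
    uniqueDiffOn_convex hKconv ⟨y₀, interior_maximal subset_closure Metric.isOpen_ball
      (Metric.mem_ball_self hδ)⟩
  have hBK : UniqueDiffOn ℝ (B ×ˢ K) := Metric.isOpen_ball.uniqueDiffOn.prod hKuniq
  have hF : ContDiffOn ℝ 1 F (B ×ˢ K) :=
    hΨ.mono (Set.prod_mono (subset_closure.trans hXs) hYδ)
  set F' := fderivWithin ℝ F (B ×ˢ K)
  have hF' : ∀ p ∈ B ×ˢ K, HasFDerivWithinAt F (F' p) (B ×ˢ K) p := fun p hp =>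
    (hF.differentiableOn one_ne_zero p hp).hasFDerivWithinAt
  have hF'cont : ContinuousOn F' (B ×ˢ K) := hF.continuousOn_fderivWithin hBK le_rfl
  set D : X × Y → Y →L[ℝ] Z := fun p => (F' p).comp (ContinuousLinearMap.inr ℝ X Y)
  set A : X × Y → X →L[ℝ] Z := fun p => (F' p).comp (ContinuousLinearMap.inl ℝ X Y)
  have hD : ∀ x ∈ B, ∀ y ∈ K, HasFDerivWithinAt (Ψ x) (D (x, y)) K y := fun x hx y hy =>
    (hF' (x, y) ⟨hx, hy⟩).comp y (hasFDerivAt_prodMk_right x y).hasFDerivWithinAt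
      fun _ hz => ⟨hx, hz⟩
  have hDnorm : ∀ x ∈ B, ∀ y ∈ K,
      ‖ContinuousLinearMap.id ℝ Y - (T.symm : Z →L[ℝ] Y).comp (D (x, y))‖ ≤ 1 / 2 := by
    intro x hx y hy
    have h := h2 x (subset_closure hx) y hy
    have hdiff : DifferentiableAt ℝ (Ψ x) y := by
      by_contra hn
      rw [fderiv_zero_of_not_differentiableAt hn] at h
      norm_num at h
    rwa [← (hKuniq y hy).eq hdiff.hasFDerivAt.hasFDerivWithinAt (hD x hx y hy)]
  have hinv : ∀ x ∈ B, ∀ y ∈ K, (D (x, y)).IsInvertible := by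
    intro x hx y hy
    obtain ⟨u, hu⟩ := isUnit_one_sub_of_norm_lt_one ((hDnorm x hx y hy).trans_lt one_half_lt_one)
    refine ⟨(ContinuousLinearEquiv.unitsEquiv ℝ Y u).trans T, ?_⟩
    ext v
    have : (u : Y →L[ℝ] Y) v = T.symm (D (x, y) v) := by
      rw [hu]
      simp
    simp [this]
  set G : X → Y → Y := fun x y => y - T.symm (Ψ x y)
  have hGlip : ∀ x ∈ B, ∀ y ∈ K, ∀ y' ∈ K, ‖G x y' - G x y‖ ≤ 1 / 2 * ‖y' - y‖ := by
    intro x hx y hy y' hy'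
    refine hKconv.norm_image_sub_le_of_norm_hasFDerivWithin_le (fun z hz => ?_)
      (hDnorm x hx) hy hy'
    exact (hasFDerivWithinAt_id z K).sub
      ((T.symm : Z →L[ℝ] Y).hasFDerivAt.comp_hasFDerivWithinAt z (hD x hx z hz))
  have hGmaps : ∀ x ∈ B, Set.MapsTo (G x) K K := by
    intro x hx y hy
    have hy₀ : y₀ ∈ K := subset_closure (Metric.mem_ball_self hδ)
    have hl := hGlip x hx y₀ hy₀ y hy
    have hn : ‖T.symm (Ψ x y₀)‖ ≤ δ / 2 := by
      have := T.injective.nontrivial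
      have hpos : 0 < ‖(T.symm : Z →L[ℝ] Y)‖ := T.symm.norm_pos
      calc ‖T.symm (Ψ x y₀)‖ ≤ ‖(T.symm : Z →L[ℝ] Y)‖ * ‖Ψ x y₀‖ :=
            (T.symm : Z →L[ℝ] Y).le_opNorm _
        _ ≤ ‖(T.symm : Z →L[ℝ] Y)‖ * (δ / (2 * ‖(T.symm : Z →L[ℝ] Y)‖)) := by
            gcongr
            exact h1 x (subset_closure hx)
        _ = δ / 2 := by field_simp
    rw [hKball, mem_closedBall_iff_norm] at hy ⊢
    have heq : G x y - y₀ = (G x y - G x y₀) - T.symm (Ψ x y₀) := by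
      simp only [G]
      abel
    rw [heq]
    linarith [norm_sub_le (G x y - G x y₀) (T.symm (Ψ x y₀))]
  have hex : ∀ x ∈ B, ∃ y ∈ K, Ψ x y = 0 := by
    intro x hx
    have hc : ContractingWith (1 / 2) ((hGmaps x hx).restrict (G x) K K) := by
      refine ⟨by norm_num, LipschitzWith.of_dist_le_mul fun a b => ?_⟩
      simpa [Subtype.dist_eq, dist_eq_norm] using hGlip x hx b b.2 a a.2
    obtain ⟨y, hy, hfix, -⟩ := hc.exists_fixedPoint' isClosed_closure.isComplete (hGmaps x hx)
      (subset_closure (Metric.mem_ball_self hδ)) (edist_ne_top _ _)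
    refine ⟨y, hy, ?_⟩
    simpa [Function.IsFixedPt, G] using hfix
  choose! f hfK hf0 using hex
  have hfderiv : ∀ x ∈ B,
      HasFDerivAt f (-((D (x, f x)).inverse.comp (A (x, f x)))) x := by
    intro x hx
    have hB : ∀ᶠ x' in 𝓝 x, x' ∈ B := Metric.isOpen_ball.mem_nhds hx
    have hbound : ∀ᶠ x' in 𝓝 x, ‖f x' - f x‖ ≤ 2 * ‖T.symm (Ψ x' (f x))‖ := by
      filter_upwards [hB] with x' hx'
      have hl := hGlip x' hx' (f x) (hfK x hx) (f x') (hfK x' hx')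
      have heq : f x' - f x = (G x' (f x') - G x' (f x)) - T.symm (Ψ x' (f x)) := by
        simp only [G, hf0 x' hx', map_zero]
        abel
      have := norm_sub_le (G x' (f x') - G x' (f x)) (T.symm (Ψ x' (f x)))
      rw [← heq] at this
      linarith
    have hpartial : HasFDerivAt (fun x' => Ψ x' (f x)) (A (x, f x)) x := by
      refine HasFDerivWithinAt.hasFDerivAt (s := B) ?_ hB
      exact HasFDerivWithinAt.comp (g := F) (f := fun x' => (x', f x)) x
        (hF' (x, f x) ⟨hx, hfK x hx⟩) (hasFDerivAt_prodMk_left x (f x)).hasFDerivWithinAt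
        fun _ hz => ⟨hz, hfK x hx⟩
    have hO : (fun x' => f x' - f x) =O[𝓝 x] fun x' => x' - x := by
      refine (IsBigO.of_bound 2 hbound).trans
        (((T.symm : Z →L[ℝ] Y).isBigO_comp _ _).trans ?_)
      simpa [hf0 x hx] using hpartial.isBigO_sub
    refine (hF' (x, f x) ⟨hx, hfK x hx⟩).hasFDerivAt_implicit (hinv x hx _ (hfK x hx))
      (hB.mono fun x' hx' => ⟨hx', hfK x' hx'⟩) (hB.mono fun x' hx' => ?_) hO
    simp [F, hf0 x' hx', hf0 x hx]
  have hgraph : ContinuousOn (fun x => F' (x, f x)) B :=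
    hF'cont.comp (continuousOn_id.prodMk fun x hx => (hfderiv x hx).continuousAt.continuousWithinAt)
      fun x hx => ⟨hx, hfK x hx⟩
  refine ⟨f, ?_, fun x hx => ⟨hfK x hx, hf0 x hx⟩⟩
  rw [show (1 : WithTop ℕ∞) = 0 + 1 by simp,
    contDiffOn_succ_iff_fderiv_of_isOpen Metric.isOpen_ball]
  refine ⟨fun x hx => (hfderiv x hx).differentiableAt.differentiableWithinAt, by simp, ?_⟩
  rw [contDiffOn_zero]
  refine ContinuousOn.congr ?_ fun x hx => (hfderiv x hx).fderiv
  have hDinv : ContinuousOn (fun x => (D (x, f x)).inverse) B := by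
    intro x hx
    obtain ⟨e, he⟩ := hinv x hx _ (hfK x hx)
    have h : ContinuousAt ContinuousLinearMap.inverse (D (x, f x)) := by
      rw [← he]
      exact (contDiffAt_map_inverse (n := 0) e).continuousAt
    exact h.comp_continuousWithinAt (f := fun x => D (x, f x))
      ((hgraph.clm_comp continuousOn_const) x hx)
  exact (hDinv.clm_comp (hgraph.clm_comp continuousOn_const)).neg
end

section
/- (Generalized Newhouse Gap Lemma.) Let K₁,…,K_d (d≥2) be nonempty compact subsets of ℝ. For a nonempty compact K⊂ℝ, a gap of K is a connected component of ℝ∖K; set Γ(K) := sup{ℓ(U) : U a bounded gap of K} (with Γ(K)=0 if there are none), where ℓ denotes length. For a boundary point u of a bounded gap U of K, the bridge C of K at u is the maximal interval such that u is a boundary point of C and C contains no point of any gap V with ℓ(V) ≥ ℓ(U); the thickness of K at u is τ(K,u) := ℓ(C)/ℓ(U), and τ(K) := inf over all such boundary points u of τ(K,u) (τ(K)=+∞ if K has no bounded gap). Assume Γ(K_j) ≤ diam(K_i) for all 1≤j<i≤d, and Γ(K_i) ≤ diam(K₁)+⋯+diam(K_{i−1}) for all 2≤i≤d. If Σ_{i=1}^d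 τ(K_i)/(τ(K_i)+1) ≥ 1, then the sumset K₁+⋯+K_d is an interval (and has infinite thickness). -/
open scoped ENNReal BigOperators
noncomputable section

/-- Length `ℓ(I) = sSup I − sInf I` of a bounded interval; also the diameter
`diam K = sup K − inf K` of a nonempty compact set. -/
def len (S : Set ℝ) : ℝ := sSup S - sInf S

/-- `U` is a gap of `K`: a connected component of `ℝ ∖ K`. -/
def IsGap (K U : Set ℝ) : Prop := ∃ x ∈ Kᶜ, U = connectedComponentIn Kᶜ x

/-- `U` is a bounded gap of `K`. -/
def IsBoundedGap (K U : Set ℝ) : Prop := IsGap K U ∧ Bornology.IsBounded U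

/-- `Γ(K) = sup {ℓ(U) : U a bounded gap of K}` (`= 0` if there are none, by the junk
value of `sSup ∅` in `ℝ`). -/
def Gam (K : Set ℝ) : ℝ := sSup {l : ℝ | ∃ U : Set ℝ, IsBoundedGap K U ∧ l = len U}

/-- The bridge of `K` at a boundary point `u` of a bounded gap `U`: the maximal interval
with boundary point `u` meeting no gap `V` (bounded or not) with `ℓ(V) ≥ ℓ(U)`,
realized as the connected component of `u` in the complement of the union of all such gaps. -/
def bridge (K U : Set ℝ) (u : ℝ) : Set ℝ :=
  connectedComponentIn
    (⋃ V ∈ {V : Set ℝ | IsGap K V ∧ (¬Bornology.IsBounded V ∨ len U ≤ len V)}, V)ᶜ u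

/-- The thickness `τ(K) = inf_u ℓ(C_u)/ℓ(U_u) ∈ [0,∞]`, the infimum running over all
boundary points `u` of bounded gaps `U` of `K` (`τ(K) = ∞` if `K` has no bounded gap). -/
def thickness (K : Set ℝ) : ℝ≥0∞ :=
  ⨅ (U : Set ℝ) (_ : IsBoundedGap K U) (u : ℝ) (_ : u ∈ frontier U),
    ENNReal.ofReal (len (bridge K U u) / len U)

/-- `(u, v)` is a possibly degenerate complementary interval of `K` with endpoints in `K`. -/
structure IsGapPair (K : Set ℝ) (u v : ℝ) : Prop where
  left_mem : u ∈ K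
  right_mem : v ∈ K
  le : u ≤ v
  le_or_le : ∀ x ∈ K, x ≤ u ∨ v ≤ x

theorem len_Ioo {u v : ℝ} (h : u < v) : len (Set.Ioo u v) = v - u := by
  rw [len, csSup_Ioo h, csInf_Ioo h]

theorem IsGapPair.isGap {K : Set ℝ} {u v : ℝ} (h : IsGapPair K u v) (huv : u < v) :
    IsGap K (Set.Ioo u v) := by
  have hsub : Set.Ioo u v ⊆ Kᶜ := fun x hx hxK => by
    rcases h.le_or_le x hxK with h1 | h1
    · exact absurd hx.1 (not_lt.2 h1)
    · exact absurd hx.2 (not_lt.2 h1)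
  have hm : (u + v) / 2 ∈ Set.Ioo u v := ⟨by linarith, by linarith⟩
  refine ⟨(u + v) / 2, hsub hm, Set.Subset.antisymm
    (isPreconnected_Ioo.subset_connectedComponentIn hm hsub) fun x hx => ?_⟩
  have hcon : (connectedComponentIn Kᶜ ((u + v) / 2)).OrdConnected :=
    isPreconnected_connectedComponentIn.ordConnected
  have hmem := mem_connectedComponentIn (hsub hm)
  refine ⟨?_, ?_⟩
  · by_contra! hlt
    exact connectedComponentIn_subset _ _ (hcon.out hx hmem ⟨hlt, hm.1.le⟩) h.left_mem
  · by_contra! hlt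
    exact connectedComponentIn_subset _ _ (hcon.out hmem hx ⟨hm.2.le, hlt⟩) h.right_mem

theorem IsGapPair.isBoundedGap {K : Set ℝ} {u v : ℝ} (h : IsGapPair K u v) (huv : u < v) :
    IsBoundedGap K (Set.Ioo u v) :=
  ⟨h.isGap huv, Metric.isBounded_Ioo u v⟩

theorem not_isBounded_component_of_lt {K : Set ℝ} {m : ℝ} (hm : ∀ x ∈ K, m ≤ x) {x : ℝ}
    (hx : x < m) :
    ¬ Bornology.IsBounded (connectedComponentIn Kᶜ x) ∧ x ∈ connectedComponentIn Kᶜ x := by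
  have hsub : Set.Iio m ⊆ Kᶜ := fun y hy hyK => absurd hy (not_lt.2 (hm y hyK))
  refine ⟨fun hb => ?_, mem_connectedComponentIn (hsub hx)⟩
  exact not_bddBelow_Iio m
    ((hb.subset (isPreconnected_Iio.subset_connectedComponentIn hx hsub)).bddBelow)

theorem not_isBounded_component_of_gt {K : Set ℝ} {m : ℝ} (hm : ∀ x ∈ K, x ≤ m) {x : ℝ}
    (hx : m < x) :
    ¬ Bornology.IsBounded (connectedComponentIn Kᶜ x) ∧ x ∈ connectedComponentIn Kᶜ x := by
  have hsub : Set.Ioi m ⊆ Kᶜ := fun y hy hyK => absurd hy (not_lt.2 (hm y hyK))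
  refine ⟨fun hb => ?_, mem_connectedComponentIn (hsub hx)⟩
  exact not_bddAbove_Ioi m
    ((hb.subset (isPreconnected_Ioi.subset_connectedComponentIn hx hsub)).bddAbove)

theorem IsBoundedGap.subset_Icc {K U : Set ℝ} (hU : IsBoundedGap K U) {m M : ℝ}
    (hm : ∀ x ∈ K, m ≤ x) (hM : ∀ x ∈ K, x ≤ M) : U ⊆ Set.Icc m M := by
  obtain ⟨⟨y, hy, rfl⟩, hb⟩ := hU
  intro x hx
  rw [connectedComponentIn_eq hx] at hb
  exact ⟨not_lt.1 fun h => (not_isBounded_component_of_lt hm h).1 hb,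
    not_lt.1 fun h => (not_isBounded_component_of_gt hM h).1 hb⟩

theorem IsBoundedGap.nonempty {K U : Set ℝ} (hU : IsBoundedGap K U) : U.Nonempty := by
  obtain ⟨⟨y, hy, rfl⟩, -⟩ := hU
  exact ⟨y, mem_connectedComponentIn hy⟩

theorem len_le_of_subset_Icc {S : Set ℝ} {a b : ℝ} (hS : S ⊆ Set.Icc a b) (hab : a ≤ b) :
    len S ≤ b - a := by
  rcases S.eq_empty_or_nonempty with rfl | hne
  · simp [len, hab]
  · exact sub_le_sub (csSup_le hne fun x hx => (hS hx).2) (le_csInf hne fun x hx => (hS hx).1)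

theorem IsGapPair.sub_le_Gam {K : Set ℝ} (hK : IsCompact K) {u v : ℝ} (h : IsGapPair K u v)
    (huv : u < v) : v - u ≤ Gam K := by
  refine le_csSup ⟨sSup K - sInf K, ?_⟩ ⟨_, h.isBoundedGap huv, (len_Ioo huv).symm⟩
  rintro _ ⟨U, hU, rfl⟩
  have hm : ∀ x ∈ K, sInf K ≤ x := fun x hx => csInf_le hK.bddBelow hx
  have hM : ∀ x ∈ K, x ≤ sSup K := fun x hx => le_csSup hK.bddAbove hx
  exact len_le_of_subset_Icc (hU.subset_Icc hm hM) ((hm u h.left_mem).trans (hM u h.left_mem))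

theorem thickness_Icc (a b : ℝ) : thickness (Set.Icc a b) = ∞ := by
  have : ∀ U, ¬ IsBoundedGap (Set.Icc a b) U := fun U hU => by
    obtain ⟨x, hx⟩ := hU.nonempty
    have hx' := hU.subset_Icc (fun _ h => h.1) (fun _ h => h.2) hx
    obtain ⟨⟨y, hy, rfl⟩, -⟩ := hU
    exact connectedComponentIn_subset _ _ hx hx'
  simp [thickness, this]

theorem bridge_subset_Icc {K U : Set ℝ} {z p q : ℝ}
    (hleft : ∀ x < p, ∃ V, IsGap K V ∧ (¬ Bornology.IsBounded V ∨ len U ≤ len V) ∧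
      ∃ y ∈ V, x ≤ y ∧ y ≤ z)
    (hright : ∀ x, q < x → ∃ V, IsGap K V ∧ (¬ Bornology.IsBounded V ∨ len U ≤ len V) ∧
      ∃ y ∈ V, z ≤ y ∧ y ≤ x) : bridge K U z ⊆ Set.Icc p q := by
  intro x hx
  have hcon : (bridge K U z).OrdConnected := isPreconnected_connectedComponentIn.ordConnected
  have hz : z ∈ bridge K U z :=
    mem_connectedComponentIn (connectedComponentIn_nonempty_iff.1 ⟨x, hx⟩)
  have key : ∀ V, IsGap K V → (¬ Bornology.IsBounded V ∨ len U ≤ len V) →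
      ∀ y ∈ V, y ∉ bridge K U z := fun V hV hV' y hy hyb =>
    connectedComponentIn_subset _ _ hyb (Set.mem_biUnion (show V ∈ {V | _} from ⟨hV, hV'⟩) hy)
  refine ⟨not_lt.1 fun h => ?_, not_lt.1 fun h => ?_⟩
  · obtain ⟨V, hV, hV', y, hy, h1, h2⟩ := hleft x h
    exact key V hV hV' y hy (hcon.out hx hz ⟨h1, h2⟩)
  · obtain ⟨V, hV, hV', y, hy, h1, h2⟩ := hright x h
    exact key V hV hV' y hy (hcon.out hz hx ⟨h1, h2⟩)

theorem IsGapPair.thickness_le {K : Set ℝ} {u v z : ℝ} (h : IsGapPair K u v) (huv : u < v)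
    (hz : z = u ∨ z = v) {p q : ℝ} (hpq : p ≤ q)
    (hb : bridge K (Set.Ioo u v) z ⊆ Set.Icc p q) :
    thickness K ≤ ENNReal.ofReal ((q - p) / (v - u)) := by
  have hzf : z ∈ frontier (Set.Ioo u v) := by
    rw [frontier_Ioo huv]
    simpa using hz
  refine (iInf₂_le_of_le _ (h.isBoundedGap huv) (iInf₂_le z hzf)).trans
    (ENNReal.ofReal_le_ofReal ?_)
  rw [len_Ioo huv]
  exact div_le_div_of_nonneg_right (len_le_of_subset_Icc hb hpq) (sub_pos.2 huv).le

/-- The normalized thickness `τ / (τ + 1)` as a real number. -/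
def normThickness (K : Set ℝ) : ℝ := (1 - (thickness K + 1)⁻¹).toReal

theorem normThickness_nonneg (K : Set ℝ) : 0 ≤ normThickness K := ENNReal.toReal_nonneg

theorem normThickness_le_one (K : Set ℝ) : normThickness K ≤ 1 :=
  ENNReal.toReal_le_of_le_ofReal zero_le_one (by simp)

theorem normThickness_le {K : Set ℝ} {q : ℝ} (hq : 0 ≤ q)
    (h : thickness K ≤ ENNReal.ofReal q) :
    normThickness K < 1 ∧ normThickness K ≤ (1 - normThickness K) * q := by
  have hq1 : 0 < q + 1 := by linarith
  have hle : normThickness K ≤ 1 - (q + 1)⁻¹ := by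
    refine ENNReal.toReal_le_of_le_ofReal (sub_nonneg.2 (inv_le_one_of_one_le₀ (by linarith))) ?_
    rw [ENNReal.ofReal_sub _ (inv_nonneg.2 hq1.le), ENNReal.ofReal_one,
      ENNReal.ofReal_inv_of_pos hq1, ENNReal.ofReal_add hq zero_le_one, ENNReal.ofReal_one]
    gcongr
  have hmul := mul_le_mul_of_nonneg_right hle hq1.le
  rw [sub_mul, inv_mul_cancel₀ hq1.ne'] at hmul
  exact ⟨hle.trans_lt (by linarith [inv_pos.2 hq1]), by linarith⟩

theorem IsGapPair.normThickness_le_of_bridge {K : Set ℝ} {u v z : ℝ} (h : IsGapPair K u v)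
    (huv : u < v) (hz : z = u ∨ z = v) {p q : ℝ} (hpq : p ≤ q)
    (hb : bridge K (Set.Ioo u v) z ⊆ Set.Icc p q) :
    normThickness K < 1 ∧
      normThickness K * (v - u) ≤ (1 - normThickness K) * (q - p) := by
  have huv' := sub_pos.2 huv
  obtain ⟨h1, h2⟩ := normThickness_le (div_nonneg (sub_nonneg.2 hpq) huv'.le)
    (h.thickness_le huv hz hpq hb)
  refine ⟨h1, ?_⟩
  rwa [← mul_div_assoc, le_div_iff₀ huv'] at h2

theorem IsGapPair.exists_gap {K : Set ℝ} {u v c e : ℝ} (huv : u < v) (hce : IsGapPair K c e)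
    (hle : v - u ≤ e - c) :
    IsGap K (Set.Ioo c e) ∧
      (¬ Bornology.IsBounded (Set.Ioo c e) ∨ len (Set.Ioo u v) ≤ len (Set.Ioo c e)) := by
  have : c < e := by linarith
  exact ⟨hce.isGap this, Or.inr (by rwa [len_Ioo huv, len_Ioo this])⟩

theorem exists_mem_gap_of_lt {K : Set ℝ} {u v a : ℝ} (huv : u < v)
    (ha : (∀ x ∈ K, a ≤ x) ∨ ∃ c, IsGapPair K c a ∧ v - u ≤ a - c) {x : ℝ} (hx : x < a) :
    ∃ V, IsGap K V ∧ (¬ Bornology.IsBounded V ∨ len (Set.Ioo u v) ≤ len V) ∧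
      ∃ y ∈ V, x ≤ y ∧ y ≤ a := by
  rcases ha with ha | ⟨c, hc, hle⟩
  · obtain ⟨h1, h2⟩ := not_isBounded_component_of_lt ha hx
    exact ⟨_, ⟨x, fun hxK => absurd hx (not_lt.2 (ha x hxK)), rfl⟩, Or.inl h1, x, h2, le_rfl, hx.le⟩
  · obtain ⟨h1, h2⟩ := IsGapPair.exists_gap huv hc hle
    obtain ⟨y, hy1, hy2⟩ := exists_between (max_lt hx (show c < a by linarith))
    exact ⟨_, h1, h2, y, ⟨(le_max_right _ _).trans_lt hy1, hy2⟩,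
      ((le_max_left _ _).trans_lt hy1).le, hy2.le⟩

theorem exists_mem_gap_of_gt {K : Set ℝ} {u v b : ℝ} (huv : u < v)
    (hb : (∀ x ∈ K, x ≤ b) ∨ ∃ c, IsGapPair K b c ∧ v - u ≤ c - b) {x : ℝ} (hx : b < x) :
    ∃ V, IsGap K V ∧ (¬ Bornology.IsBounded V ∨ len (Set.Ioo u v) ≤ len V) ∧
      ∃ y ∈ V, b ≤ y ∧ y ≤ x := by
  rcases hb with hb | ⟨c, hc, hle⟩
  · obtain ⟨h1, h2⟩ := not_isBounded_component_of_gt hb hx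
    exact ⟨_, ⟨x, fun hxK => absurd hx (not_lt.2 (hb x hxK)), rfl⟩, Or.inl h1, x, h2, hx.le, le_rfl⟩
  · obtain ⟨h1, h2⟩ := IsGapPair.exists_gap huv hc hle
    obtain ⟨y, hy1, hy2⟩ := exists_between (lt_min hx (show b < c by linarith))
    exact ⟨_, h1, h2, y, ⟨hy1, hy2.trans_le (min_le_right _ _)⟩, hy1.le,
      (hy2.trans_le (min_le_left _ _)).le⟩

theorem IsGapPair.normThickness_left {K : Set ℝ} {u v a : ℝ} (h : IsGapPair K u v)
    (huv : u < v) (hau : a ≤ u)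
    (ha : (∀ x ∈ K, a ≤ x) ∨ ∃ c, IsGapPair K c a ∧ v - u ≤ a - c) :
    normThickness K < 1 ∧
      normThickness K * (v - u) ≤ (1 - normThickness K) * (u - a) := by
  refine h.normThickness_le_of_bridge huv (Or.inl rfl) hau (bridge_subset_Icc ?_ ?_)
  · intro x hx
    obtain ⟨V, hV, hV', y, hy, h1, h2⟩ := exists_mem_gap_of_lt huv ha hx
    exact ⟨V, hV, hV', y, hy, h1, h2.trans hau⟩
  · intro x hx
    exact exists_mem_gap_of_gt huv (Or.inr ⟨v, h, le_rfl⟩) hx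

theorem IsGapPair.normThickness_right {K : Set ℝ} {u v b : ℝ} (h : IsGapPair K u v)
    (huv : u < v) (hvb : v ≤ b)
    (hb : (∀ x ∈ K, x ≤ b) ∨ ∃ c, IsGapPair K b c ∧ v - u ≤ c - b) :
    normThickness K < 1 ∧
      normThickness K * (v - u) ≤ (1 - normThickness K) * (b - v) := by
  refine h.normThickness_le_of_bridge huv (Or.inr rfl) hvb (bridge_subset_Icc ?_ ?_)
  · intro x hx
    exact exists_mem_gap_of_lt huv (Or.inr ⟨u, h, le_rfl⟩) hx
  · intro x hx
    obtain ⟨V, hV, hV', y, hy, h1, h2⟩ := exists_mem_gap_of_gt huv hb hx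
    exact ⟨V, hV, hV', y, hy, hvb.trans h1, h2⟩

theorem IsGapPair.normThickness_lt_one {K : Set ℝ} (hK : IsCompact K) {u v : ℝ}
    (h : IsGapPair K u v) (huv : u < v) : normThickness K < 1 :=
  (h.normThickness_left huv (csInf_le hK.bddBelow h.left_mem)
    (Or.inl fun _ hx => csInf_le hK.bddBelow hx)).1

theorem exists_isGapPair_around {K : Set ℝ} (hK : IsCompact K) {a b x : ℝ} (ha : a ∈ K)
    (hb : b ∈ K) (hx : x ∈ Set.Icc a b) :
    ∃ u v, IsGapPair K u v ∧ a ≤ u ∧ u ≤ x ∧ x ≤ v ∧ v ≤ b := by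
  obtain ⟨u, hu, humax⟩ := (hK.inter_right isClosed_Iic).exists_isGreatest ⟨a, ha, hx.1⟩
  obtain ⟨v, hv, hvmin⟩ := (hK.inter_right isClosed_Ici).exists_isLeast ⟨b, hb, hx.2⟩
  refine ⟨u, v, ⟨hu.1, hv.1, le_trans hu.2 hv.2, fun y hy => ?_⟩, humax ⟨ha, hx.1⟩, hu.2, hv.2,
    hvmin ⟨hb, hx.2⟩⟩
  exact (le_total y x).imp (fun h => humax ⟨hy, h⟩) (fun h => hvmin ⟨hy, h⟩)

theorem exists_max_isGapPair {K : Set ℝ} (hK : IsCompact K) {a b : ℝ} (ha : a ∈ K)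
    (hab : a ≤ b) :
    ∃ u v, IsGapPair K u v ∧ a ≤ u ∧ v ≤ b ∧
      ∀ u' v', IsGapPair K u' v' → a ≤ u' → v' ≤ b → v' - u' ≤ v - u := by
  let S : Set (ℝ × ℝ) := {p | IsGapPair K p.1 p.2 ∧ a ≤ p.1 ∧ p.2 ≤ b}
  have hS : S = (K ×ˢ K) ∩ {p | p.1 ≤ p.2 ∧ (∀ x ∈ K, x ≤ p.1 ∨ p.2 ≤ x) ∧ a ≤ p.1 ∧ p.2 ≤ b} := by
    ext p
    exact ⟨fun h => ⟨⟨h.1.1, h.1.2⟩, h.1.3, h.1.4, h.2⟩,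
      fun h => ⟨⟨h.1.1, h.1.2, h.2.1, h.2.2.1⟩, h.2.2.2⟩⟩
  have hScpt : IsCompact S := by
    rw [hS]
    refine (hK.prod hK).inter_right ?_
    refine (isClosed_le continuous_fst continuous_snd).inter (IsClosed.inter ?_
      ((isClosed_le continuous_const continuous_fst).inter
        (isClosed_le continuous_snd continuous_const)))
    have : {p : ℝ × ℝ | ∀ x ∈ K, x ≤ p.1 ∨ p.2 ≤ x} =
        ⋂ x ∈ K, ({p : ℝ × ℝ | x ≤ p.1} ∪ {p | p.2 ≤ x}) := by
      ext p
      simp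
    change IsClosed {p : ℝ × ℝ | ∀ x ∈ K, x ≤ p.1 ∨ p.2 ≤ x}
    rw [this]
    exact isClosed_biInter fun x _ => (isClosed_le continuous_const continuous_fst).union
      (isClosed_le continuous_snd continuous_const)
  obtain ⟨p, hp, hmax⟩ := hScpt.exists_isMaxOn
    ⟨(a, a), ⟨ha, ha, le_rfl, fun x _ => le_total x a⟩, le_rfl, hab⟩
    (continuous_snd.sub continuous_fst).continuousOn
  exact ⟨p.1, p.2, hp.1, hp.2.1, hp.2.2, fun u' v' h h1 h2 =>
    hmax (show (u', v') ∈ S from ⟨h, h1, h2⟩)⟩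

/-- `[a, b]` is obtained from the hull of `K` by removing gaps of length at least
`(1 - γ) W`, where `γ` is the normalized thickness of `K`, and the gaps of `K` inside `[a, b]`
have length at most `(1 - γ) W`. -/
structure IsPiece (K : Set ℝ) (W a b : ℝ) : Prop where
  left_mem : a ∈ K
  right_mem : b ∈ K
  le : a ≤ b
  left : (∀ x ∈ K, a ≤ x) ∨ ∃ c, IsGapPair K c a ∧ (1 - normThickness K) * W ≤ a - c
  right : (∀ x ∈ K, x ≤ b) ∨ ∃ c, IsGapPair K b c ∧ (1 - normThickness K) * W ≤ c - b
  hull_or_cut : b - a = len K ∨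
    (normThickness K * W ≤ b - a ∧ (1 - normThickness K) * W ≤ Gam K)
  gap_le : ∀ u v, IsGapPair K u v → a ≤ u → v ≤ b → v - u ≤ (1 - normThickness K) * W

theorem IsPiece.anti {K : Set ℝ} {W W' a b : ℝ} (h : IsPiece K W a b) (hW : W' ≤ W)
    (hgap : ∀ u v, IsGapPair K u v → a ≤ u → v ≤ b → v - u ≤ (1 - normThickness K) * W') :
    IsPiece K W' a b := by
  have h1 : (1 - normThickness K) * W' ≤ (1 - normThickness K) * W :=
    mul_le_mul_of_nonneg_left hW (sub_nonneg.2 (normThickness_le_one K))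
  have h2 : normThickness K * W' ≤ normThickness K * W :=
    mul_le_mul_of_nonneg_left hW (normThickness_nonneg K)
  exact ⟨h.left_mem, h.right_mem, h.le,
    h.left.imp_right fun ⟨c, hc, hc'⟩ => ⟨c, hc, h1.trans hc'⟩,
    h.right.imp_right fun ⟨c, hc, hc'⟩ => ⟨c, hc, h1.trans hc'⟩,
    h.hull_or_cut.imp_right fun h => ⟨h2.trans h.1, h1.trans h.2⟩, hgap⟩

theorem IsPiece.cut {K : Set ℝ} (hK : IsCompact K) {W a b u v : ℝ} (h : IsPiece K W a b)
    (huv : IsGapPair K u v) (hlt : u < v) (hau : a ≤ u) (hvb : v ≤ b)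
    (hW : v - u = (1 - normThickness K) * W) : IsPiece K W a u ∧ IsPiece K W v b := by
  have hγ : 0 < 1 - normThickness K := sub_pos.2 (huv.normThickness_lt_one hK hlt)
  have hGam : (1 - normThickness K) * W ≤ Gam K := hW ▸ huv.sub_le_Gam hK hlt
  have hl := (huv.normThickness_left hlt hau (by rw [hW]; exact h.left)).2
  have hr := (huv.normThickness_right hlt hvb (by rw [hW]; exact h.right)).2
  rw [hW, mul_left_comm] at hl hr
  exact ⟨⟨h.left_mem, huv.left_mem, hau, h.left, Or.inr ⟨v, huv, hW.ge⟩,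
      Or.inr ⟨le_of_mul_le_mul_left hl hγ, hGam⟩,
      fun u' v' h1 h2 h3 => h.gap_le u' v' h1 h2 (by linarith)⟩,
    ⟨huv.right_mem, h.right_mem, hvb, Or.inr ⟨u, huv, hW.ge⟩, h.right,
      Or.inr ⟨le_of_mul_le_mul_left hr hγ, hGam⟩,
      fun u' v' h1 h2 h3 => h.gap_le u' v' h1 (by linarith) h3⟩⟩

theorem exists_max_weighted_gap {d : ℕ} (hd : 2 ≤ d) {K : Fin d → Set ℝ}
    (hcpt : ∀ i, IsCompact (K i)) {a b : Fin d → ℝ} (ha : ∀ i, a i ∈ K i)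
    (hab : ∀ i, a i ≤ b i) :
    ∃ W : ℝ, 0 ≤ W ∧
      (∀ i u v, IsGapPair (K i) u v → a i ≤ u → v ≤ b i → v - u ≤ (1 - normThickness (K i)) * W) ∧
      (W = 0 ∨ ∃ l u v, normThickness (K l) < 1 ∧ IsGapPair (K l) u v ∧ a l ≤ u ∧ v ≤ b l ∧
        v - u = (1 - normThickness (K l)) * W) := by
  choose u v huv hau hvb hmax using fun i => exists_max_isGapPair (hcpt i) (ha i) (hab i)
  have : Nonempty (Fin d) := ⟨⟨0, by omega⟩⟩
  obtain ⟨l, hl⟩ := Finite.exists_max fun i => (v i - u i) / (1 - normThickness (K i))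
  refine ⟨_, div_nonneg (sub_nonneg.2 (huv l).le) (sub_nonneg.2 (normThickness_le_one (K l))),
    fun i u' v' h h1 h2 => ?_, ?_⟩
  · rcases h.le.eq_or_lt with heq | hlt
    · rw [heq, sub_self]
      exact mul_nonneg (sub_nonneg.2 (normThickness_le_one _))
        (div_nonneg (sub_nonneg.2 (huv l).le) (sub_nonneg.2 (normThickness_le_one (K l))))
    · have hγ := sub_pos.2 (h.normThickness_lt_one (hcpt i) hlt)
      refine (hmax i u' v' h h1 h2).trans ?_
      rw [← div_le_iff₀' hγ]
      exact hl i
  · rcases (normThickness_le_one (K l)).eq_or_lt with heq | hlt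
    · left
      simp [heq]
    · exact Or.inr ⟨l, u l, v l, hlt, huv l, hau l, hvb l,
        (mul_div_cancel₀ _ (sub_pos.2 hlt).ne').symm⟩

/-- The largest weighted gap is at most the total length of the other pieces. -/
theorem max_weighted_gap_le_sum {d : ℕ} {K : Fin d → Set ℝ}
    (hΓ1 : ∀ i j : Fin d, j < i → Gam (K j) ≤ len (K i))
    (hΓ2 : ∀ i : Fin d, 0 < (i : ℕ) →
        Gam (K i) ≤ ∑ j ∈ Finset.univ.filter (fun j : Fin d => j < i), len (K j))
    (hthick : 1 ≤ ∑ i, normThickness (K i)) {W : ℝ} (hW : 0 ≤ W) {a b : Fin d → ℝ}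
    (hp : ∀ i, IsPiece (K i) W (a i) (b i)) {l : Fin d}
    (hl : (1 - normThickness (K l)) * W ≤ Gam (K l)) :
    (1 - normThickness (K l)) * W ≤ ∑ j ∈ Finset.univ.erase l, (b j - a j) := by
  have hnn : ∀ j, 0 ≤ b j - a j := fun j => sub_nonneg.2 (hp j).le
  by_cases hall : ∀ j, j ≠ l → b j - a j ≠ len (K j)
  · calc (1 - normThickness (K l)) * W
        ≤ (∑ j ∈ Finset.univ.erase l, normThickness (K j)) * W := by
          refine mul_le_mul_of_nonneg_right ?_ hW
          rw [← Finset.add_sum_erase _ _ (Finset.mem_univ l)] at hthick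
          linarith
      _ ≤ ∑ j ∈ Finset.univ.erase l, (b j - a j) := by
          rw [Finset.sum_mul]
          exact Finset.sum_le_sum fun j hj =>
            ((hp j).hull_or_cut.resolve_left (hall j (Finset.ne_of_mem_erase hj))).1
  push Not at hall
  obtain ⟨j₀, hj₀l, hj₀⟩ := hall
  obtain ⟨m, hm, hmin⟩ := wellFounded_lt.has_min
    {j : Fin d | j = l ∨ b j - a j ≠ len (K j)} ⟨l, Or.inl rfl⟩
  have hmGam : (1 - normThickness (K m)) * W ≤ Gam (K m) := by
    rcases hm with rfl | hm
    · exact hl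
    · exact ((hp m).hull_or_cut.resolve_left hm).2
  obtain ⟨A, hmA, hlA, hA⟩ : ∃ A : Finset (Fin d), m ∉ A ∧ l ∉ A ∧
      Gam (K m) ≤ ∑ j ∈ A, (b j - a j) := by
    rcases Nat.eq_zero_or_pos (m : ℕ) with h0 | hpos
    · have hne : m ≠ j₀ := by
        rintro rfl
        exact hm.elim hj₀l fun h => h hj₀
      refine ⟨{j₀}, by simpa using hne, by simpa using hj₀l.symm, ?_⟩
      rw [Finset.sum_singleton, hj₀]
      refine hΓ1 j₀ m (Fin.lt_def.2 ?_)
      have : (m : ℕ) ≠ j₀ := fun h => hne (Fin.ext h)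
      omega
    · refine ⟨Finset.univ.filter (· < m), by simp, ?_, (hΓ2 m hpos).trans_eq ?_⟩
      · simpa using not_lt.1 (hmin l (Or.inl rfl))
      · refine Finset.sum_congr rfl fun j hj => ?_
        by_contra hne
        exact hmin j (Or.inr (Ne.symm hne)) (Finset.mem_filter.1 hj).2
  by_cases hml : m = l
  · subst hml
    refine (hmGam.trans hA).trans (Finset.sum_le_sum_of_subset_of_nonneg ?_ fun j _ _ => hnn j)
    exact fun j hj => Finset.mem_erase.2 ⟨fun h => hmA (h ▸ hj), Finset.mem_univ j⟩
  · have hmcut := ((hp m).hull_or_cut.resolve_left (hm.resolve_left hml)).1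
    calc (1 - normThickness (K l)) * W ≤ W :=
          mul_le_of_le_one_left hW (by linarith [normThickness_nonneg (K l)])
      _ ≤ ∑ j ∈ insert m A, (b j - a j) := by
          rw [Finset.sum_insert hmA]
          linarith
      _ ≤ _ := by
          refine Finset.sum_le_sum_of_subset_of_nonneg ?_ fun j _ _ => hnn j
          intro j hj
          refine Finset.mem_erase.2 ⟨?_, Finset.mem_univ j⟩
          rintro rfl
          exact (Finset.mem_insert.1 hj).elim (fun h => hml h.symm) hlA

theorem exists_cut_pieces {d : ℕ} {K : Fin d → Set ℝ} (hcpt : ∀ i, IsCompact (K i))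
    {t W : ℝ} {a b : Fin d → ℝ} (hp : ∀ i, IsPiece (K i) W (a i) (b i))
    (hta : ∑ i, a i ≤ t) (htb : t ≤ ∑ i, b i) {l : Fin d} {u v : ℝ}
    (huv : IsGapPair (K l) u v) (hlt : u < v) (hau : a l ≤ u) (hvb : v ≤ b l)
    (hW : v - u = (1 - normThickness (K l)) * W)
    (hle : v - u ≤ ∑ j ∈ Finset.univ.erase l, (b j - a j)) :
    ∃ a' b' : Fin d → ℝ, (∀ i, IsPiece (K i) W (a' i) (b' i)) ∧ ∑ i, a' i ≤ t ∧
      t ≤ ∑ i, b' i ∧ ∑ i, (b' i - a' i) ≤ ∑ i, (b i - a i) - (v - u) := by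
  obtain ⟨hp1, hp2⟩ := (hp l).cut (hcpt l) huv hlt hau hvb hW
  have hupd : ∀ (f : Fin d → ℝ) (x : ℝ),
      ∑ i, Function.update f l x i = ∑ i, f i - f l + x := by
    intro f x
    rw [Finset.sum_update_of_mem (Finset.mem_univ l), Finset.sdiff_singleton_eq_erase,
      ← Finset.add_sum_erase _ f (Finset.mem_univ l)]
    ring
  have herase := Finset.add_sum_erase _ (fun j => b j - a j) (Finset.mem_univ l)
  simp only [Finset.sum_sub_distrib] at herase hle ⊢
  by_cases ht : t ≤ ∑ i, b i - b l + u
  · refine ⟨a, Function.update b l u, fun i => ?_, hta, by rwa [hupd], by rw [hupd]; linarith⟩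
    by_cases hi : i = l
    · subst hi
      simpa using hp1
    · simpa [hi] using hp i
  · refine ⟨Function.update a l v, b, fun i => ?_, by rw [hupd]; linarith, htb,
      by rw [hupd]; linarith⟩
    by_cases hi : i = l
    · subst hi
      simpa using hp2
    · simpa [hi] using hp i

theorem exists_fine_pieces {d : ℕ} (hd : 2 ≤ d) {K : Fin d → Set ℝ}
    (hcpt : ∀ i, IsCompact (K i)) (hΓ1 : ∀ i j : Fin d, j < i → Gam (K j) ≤ len (K i))
    (hΓ2 : ∀ i : Fin d, 0 < (i : ℕ) →
        Gam (K i) ≤ ∑ j ∈ Finset.univ.filter (fun j : Fin d => j < i), len (K j))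
    (hthick : 1 ≤ ∑ i, normThickness (K i)) {t ε δ : ℝ} (hε : 0 < ε) (hδ : 0 < δ)
    (hδγ : ∀ i, normThickness (K i) < 1 → δ ≤ 1 - normThickness (K i)) (n : ℕ) :
    ∀ (W : ℝ) (a b : Fin d → ℝ), 0 ≤ W → (∀ i, IsPiece (K i) W (a i) (b i)) → ∑ i, a i ≤ t →
      t ≤ ∑ i, b i → ∑ i, (b i - a i) < n * (δ * ε) →
      ∃ (W : ℝ) (a b : Fin d → ℝ), 0 ≤ W ∧ W < ε ∧ (∀ i, IsPiece (K i) W (a i) (b i)) ∧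
        ∑ i, a i ≤ t ∧ t ≤ ∑ i, b i := by
  induction n with
  | zero =>
    intro W a b _ hp _ _ hlt
    have := Finset.sum_nonneg fun i (_ : i ∈ Finset.univ) => sub_nonneg.2 (hp i).le
    simp only [Nat.cast_zero, zero_mul] at hlt
    linarith
  | succ n ih =>
    intro W₀ a b hW₀ hp₀ hta htb hlt
    obtain ⟨W, hW, hgap, hmax⟩ := exists_max_weighted_gap hd hcpt (fun i => (hp₀ i).left_mem)
      (fun i => (hp₀ i).le)
    have hWW₀ : W ≤ W₀ := by
      rcases hmax with rfl | ⟨l, u, v, hγ, huv, hau, hvb, heq⟩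
      · exact hW₀
      · exact le_of_mul_le_mul_left (heq.ge.trans ((hp₀ l).gap_le u v huv hau hvb))
          (sub_pos.2 hγ)
    have hp i := (hp₀ i).anti hWW₀ (hgap i)
    rcases lt_or_ge W ε with hWε | hWε
    · exact ⟨W, a, b, hW, hWε, hp, hta, htb⟩
    obtain ⟨l, u, v, hγ, huv, hau, hvb, heq⟩ := hmax.resolve_left (hε.trans_le hWε).ne'
    have hdiff : δ * ε ≤ v - u := heq ▸ mul_le_mul (hδγ l hγ) hWε hε.le (sub_pos.2 hγ).le
    have huv' : u < v := by linarith [mul_pos hδ hε]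
    obtain ⟨a', b', hp', hta', htb', hlt'⟩ := exists_cut_pieces hcpt hp hta htb huv huv' hau hvb
      heq (heq.trans_le (max_weighted_gap_le_sum hΓ1 hΓ2 hthick hW hp
        (heq.ge.trans (huv.sub_le_Gam (hcpt l) huv'))))
    refine ih W a' b' hW hp' hta' htb' ?_
    push_cast at hlt
    linarith

theorem exists_mem_Icc_sum_eq {ι : Type*} [Fintype ι] {a b : ι → ℝ} (hab : ∀ i, a i ≤ b i)
    {t : ℝ} (hta : ∑ i, a i ≤ t) (htb : t ≤ ∑ i, b i) :
    ∃ x : ι → ℝ, (∀ i, x i ∈ Set.Icc (a i) (b i)) ∧ ∑ i, x i = t := by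
  have hcont : ContinuousOn (fun x : ι → ℝ => ∑ i, x i) (Set.Icc a b) := by fun_prop
  exact (convex_Icc a b).isPreconnected.intermediate_value (Set.left_mem_Icc.2 hab)
    (Set.right_mem_Icc.2 hab) hcont ⟨hta, htb⟩ |>.imp
      fun x hx => ⟨fun i => ⟨hx.1.1 i, hx.1.2 i⟩, hx.2⟩

theorem exists_sum_near {d : ℕ} {K : Fin d → Set ℝ} (hcpt : ∀ i, IsCompact (K i)) {t W : ℝ}
    (hW : 0 ≤ W) {a b : Fin d → ℝ} (hp : ∀ i, IsPiece (K i) W (a i) (b i))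
    (hta : ∑ i, a i ≤ t) (htb : t ≤ ∑ i, b i) :
    ∃ f : Fin d → ℝ, (∀ i, f i ∈ K i) ∧ |t - ∑ i, f i| ≤ d * W := by
  obtain ⟨x, hx, rfl⟩ := exists_mem_Icc_sum_eq (fun i => (hp i).le) hta htb
  choose u v huv hau hux hxv hvb using fun i =>
    exists_isGapPair_around (hcpt i) (hp i).left_mem (hp i).right_mem (hx i)
  refine ⟨u, fun i => (huv i).left_mem, ?_⟩
  rw [← Finset.sum_sub_distrib]
  refine (Finset.abs_sum_le_sum_abs _ _).trans ?_
  have : ∀ i ∈ Finset.univ, |x i - u i| ≤ W := fun i _ => by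
    rw [abs_of_nonneg (sub_nonneg.2 (hux i))]
    have h1 := (hp i).gap_le _ _ (huv i) (hau i) (hvb i)
    have h2 : (1 - normThickness (K i)) * W ≤ W :=
      mul_le_of_le_one_left hW (by linarith [normThickness_nonneg (K i)])
    linarith [hxv i]
  simpa using Finset.sum_le_card_nsmul _ _ _ this

theorem exists_pos_le_one_sub {d : ℕ} (hd : 2 ≤ d) (γ : Fin d → ℝ) :
    ∃ δ > 0, ∀ i, γ i < 1 → δ ≤ 1 - γ i := by
  have : Nonempty (Fin d) := ⟨⟨0, by omega⟩⟩
  obtain ⟨l, hl⟩ := Finite.exists_min fun i => if γ i < 1 then 1 - γ i else 1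
  refine ⟨_, ?_, fun i hi => (hl i).trans_eq (if_pos hi)⟩
  split_ifs with h
  · exact sub_pos.2 h
  · exact one_pos

theorem mem_sumset_of_mem_hull {d : ℕ} (hd : 2 ≤ d) {K : Fin d → Set ℝ}
    (hne : ∀ i, (K i).Nonempty) (hcpt : ∀ i, IsCompact (K i))
    (hΓ1 : ∀ i j : Fin d, j < i → Gam (K j) ≤ len (K i))
    (hΓ2 : ∀ i : Fin d, 0 < (i : ℕ) →
        Gam (K i) ≤ ∑ j ∈ Finset.univ.filter (fun j : Fin d => j < i), len (K j))
    (hthick : 1 ≤ ∑ i, normThickness (K i)) {t : ℝ} (hta : ∑ i, sInf (K i) ≤ t)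
    (htb : t ≤ ∑ i, sSup (K i)) : ∃ f : Fin d → ℝ, (∀ i, f i ∈ K i) ∧ t = ∑ i, f i := by
  have hclosed : IsClosed ((fun f : Fin d → ℝ => ∑ i, f i) '' Set.univ.pi K) :=
    ((isCompact_univ_pi hcpt).image (by fun_prop)).isClosed
  suffices h : t ∈ closure ((fun f : Fin d → ℝ => ∑ i, f i) '' Set.univ.pi K) by
    rw [hclosed.closure_eq] at h
    obtain ⟨f, hf, rfl⟩ := h
    exact ⟨f, fun i => hf i (Set.mem_univ i), rfl⟩
  have hinf i := (hcpt i).sInf_mem (hne i)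
  have hsup i := (hcpt i).sSup_mem (hne i)
  have hle i : sInf (K i) ≤ sSup (K i) := csInf_le (hcpt i).bddBelow (hsup i)
  obtain ⟨W₀, hW₀, hgap, -⟩ := exists_max_weighted_gap hd hcpt hinf hle
  have hp₀ : ∀ i, IsPiece (K i) W₀ (sInf (K i)) (sSup (K i)) := fun i =>
    ⟨hinf i, hsup i, hle i, Or.inl fun _ hx => csInf_le (hcpt i).bddBelow hx,
      Or.inl fun _ hx => le_csSup (hcpt i).bddAbove hx, Or.inl rfl, hgap i⟩
  obtain ⟨δ, hδ, hδγ⟩ := exists_pos_le_one_sub hd fun i => normThickness (K i)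
  refine Metric.mem_closure_iff.2 fun ε hε => ?_
  have hd' : (0 : ℝ) < d := by exact_mod_cast (by omega : 0 < d)
  have hεd := div_pos hε hd'
  obtain ⟨n, hn⟩ := exists_nat_gt ((∑ i, (sSup (K i) - sInf (K i))) / (δ * (ε / d)))
  rw [div_lt_iff₀ (mul_pos hδ hεd)] at hn
  obtain ⟨W, a, b, hW, hWε, hp, ha, hb⟩ := exists_fine_pieces hd hcpt hΓ1 hΓ2 hthick hεd hδ hδγ n
    W₀ _ _ hW₀ hp₀ hta htb hn
  obtain ⟨f, hf, hft⟩ := exists_sum_near hcpt hW hp ha hb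
  refine ⟨_, ⟨f, fun i _ => hf i, rfl⟩, ?_⟩
  rw [Real.dist_eq]
  rw [lt_div_iff₀' hd'] at hWε
  exact hft.trans_lt hWε

/-- Generalized Newhouse Gap Lemma, Astels.
Note that in `ℝ≥0∞` one has `x/(x+1) = 1 - (x+1)⁻¹` for all `x`, including `x = ∞`
(where the value is `1`). -/
theorem newhouse_gap_lemma (d : ℕ) (hd : 2 ≤ d) (K : Fin d → Set ℝ)
    (hne : ∀ i, (K i).Nonempty) (hcpt : ∀ i, IsCompact (K i))
    (hΓ1 : ∀ i j : Fin d, j < i → Gam (K j) ≤ len (K i))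
    (hΓ2 : ∀ i : Fin d, 0 < (i : ℕ) →
        Gam (K i) ≤ ∑ j ∈ Finset.univ.filter (fun j : Fin d => j < i), len (K j))
    (hthick : 1 ≤ ∑ i : Fin d, (1 - (thickness (K i) + 1)⁻¹)) :
    thickness {x : ℝ | ∃ f : Fin d → ℝ, (∀ i, f i ∈ K i) ∧ x = ∑ i, f i} = ∞ ∧
    ∃ a b : ℝ, a ≤ b ∧
      {x : ℝ | ∃ f : Fin d → ℝ, (∀ i, f i ∈ K i) ∧ x = ∑ i, f i} = Set.Icc a b := by
  have hthick' : 1 ≤ ∑ i, normThickness (K i) := by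
    have hfin : ∀ i ∈ Finset.univ, (1 - (thickness (K i) + 1)⁻¹) ≠ ∞ := fun i _ =>
      ENNReal.sub_ne_top ENNReal.one_ne_top
    have := ENNReal.toReal_mono (ENNReal.sum_ne_top.2 hfin) hthick
    rwa [ENNReal.toReal_one, ENNReal.toReal_sum hfin] at this
  have hmem : ∀ f : Fin d → ℝ, (∀ i, f i ∈ K i) →
      ∑ i, f i ∈ Set.Icc (∑ i, sInf (K i)) (∑ i, sSup (K i)) := fun f hf =>
    ⟨Finset.sum_le_sum fun i _ => csInf_le (hcpt i).bddBelow (hf i),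
      Finset.sum_le_sum fun i _ => le_csSup (hcpt i).bddAbove (hf i)⟩
  have hS : {x : ℝ | ∃ f : Fin d → ℝ, (∀ i, f i ∈ K i) ∧ x = ∑ i, f i} =
      Set.Icc (∑ i, sInf (K i)) (∑ i, sSup (K i)) := by
    refine Set.Subset.antisymm ?_ fun t ht =>
      mem_sumset_of_mem_hull hd hne hcpt hΓ1 hΓ2 hthick' ht.1 ht.2
    rintro _ ⟨f, hf, rfl⟩
    exact hmem f hf
  rw [hS]
  choose f hf using hne
  exact ⟨thickness_Icc _ _, _, _, (hmem f hf).1.trans (hmem f hf).2, rfl⟩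
end
end

section
/- (Spectrum of separable operators.) Let d≥1 and let v₁,…,v_d : ℤ→ℝ be bounded. Define the bounded self-adjoint operator H on ℓ²(ℤ^d) by (Hu)(n) = Σ_{‖e‖₁=1} u(n+e) + (v₁(n₁)+⋯+v_d(n_d))·u(n), and for each j the bounded self-adjoint operator H_j on ℓ²(ℤ) by (H_j u)(n) = u(n+1)+u(n−1)+v_j(n)u(n). Then σ(H) = σ(H₁)+σ(H₂)+⋯+σ(H_d), where the right-hand side is the sumset {E₁+⋯+E_d : E_j∈σ(H_j)}. -/
open scoped BigOperators

section CommutingSums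

variable {A : Type*} [NormedRing A] [NormedAlgebra ℂ A] {ι : Type*}

/-- The spectrum of an element of a double centralizer does not depend on the ambient algebra. -/
theorem Subalgebra.spectrum_centralizer (s : Set A) (a : Subalgebra.centralizer ℂ s) :
    spectrum ℂ a = spectrum ℂ (a : A) := by
  refine (spectrum.subset_subalgebra a).antisymm' fun z hz h => hz ?_
  obtain ⟨w, hw⟩ := spectrum.mem_resolventSet_iff.1 h
  have hmem : (↑w⁻¹ : A) ∈ Subalgebra.centralizer ℂ s := by
    rw [Subalgebra.mem_centralizer_iff]
    intro g hg
    have hc : Commute g (w : A) := by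
      rw [hw]
      exact (Algebra.commute_algebraMap_right z g).sub_right
        (Subalgebra.mem_centralizer_iff ℂ |>.1 a.2 g hg)
    exact hc.units_inv_right
  refine ⟨⟨algebraMap ℂ _ z - a, ⟨_, hmem⟩, Subtype.ext ?_, Subtype.ext ?_⟩, rfl⟩
  · change (algebraMap ℂ A z - a) * ↑w⁻¹ = 1
    rw [← hw, w.mul_inv]
  · change ↑w⁻¹ * (algebraMap ℂ A z - a) = 1
    rw [← hw, w.inv_mul]

/-- In a complex Banach algebra, the spectrum of a finite sum of commuting elements is contained in
the sum of their spectra. -/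
theorem spectrum.exists_eq_sum_of_mem_sum_of_commute [CompleteSpace A] [Fintype ι] {a : ι → A}
    (ha : ∀ i j, Commute (a i) (a j)) {z : ℂ} (hz : z ∈ spectrum ℂ (∑ i, a i)) :
    ∃ E : ι → ℂ, (∀ i, E i ∈ spectrum ℂ (a i)) ∧ z = ∑ i, E i := by
  let S : Set A := Set.range a
  let B := Subalgebra.centralizer ℂ (S.centralizer)
  have hS : ∀ x ∈ S, ∀ y ∈ S, x * y = y * x := by
    rintro _ ⟨i, rfl⟩ _ ⟨j, rfl⟩
    exact ha i j
  let _ : NormedCommRing B :=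
    { (inferInstance : NormedRing B) with
      mul_comm := fun x y => Subtype.ext
        (Set.centralizer_centralizer_comm_of_comm hS _ x.2 _ y.2) }
  let _ : NormedAlgebra ℂ B := Subalgebra.toNormedAlgebra B
  have _ : CompleteSpace B :=
    (Set.isClosed_centralizer S.centralizer).completeSpace_coe
  let b : ι → B := fun i => ⟨a i, Set.subset_centralizer_centralizer ⟨i, rfl⟩⟩
  have hb : ((∑ i, b i : B) : A) = ∑ i, a i := by
    rw [AddSubmonoidClass.coe_finsetSum]
  have hz' : z ∈ spectrum ℂ (∑ i, b i : B) := by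
    rw [← hb, ← Subalgebra.spectrum_centralizer] at hz
    exact hz
  obtain ⟨φ, rfl⟩ := (WeakDual.CharacterSpace.mem_spectrum_iff_exists (A := B)).1 hz'
  refine ⟨fun i => φ (b i), fun i => ?_, map_sum φ _ _⟩
  rw [show a i = (b i : A) from rfl, ← Subalgebra.spectrum_centralizer]
  exact (WeakDual.CharacterSpace.mem_spectrum_iff_exists (A := B)).2 ⟨φ, rfl⟩

end CommutingSums

section ApproximateEigenvectors

variable {E : Type*} [NormedAddCommGroup E]

theorem ContinuousLinearMap.mem_spectrum_of_forall_exists_norm_lt [NormedSpace ℂ E]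
    {T : E →L[ℂ] E} {z : ℂ} (h : ∀ ε > 0, ∃ u, ‖u‖ = 1 ∧ ‖T u - z • u‖ < ε) :
    z ∈ spectrum ℂ T := by
  rintro ⟨w, hw⟩
  obtain ⟨u, hu, hlt⟩ := h (‖(↑w⁻¹ : E →L[ℂ] E)‖ + 1)⁻¹ (by positivity)
  have hinv : (↑w⁻¹ : E →L[ℂ] E) (z • u - T u) = u := by
    have := congrArg (fun S : E →L[ℂ] E => S u) w.inv_mul
    rw [hw] at this
    simpa [Algebra.algebraMap_eq_smul_one] using this
  have hle := (↑w⁻¹ : E →L[ℂ] E).le_opNorm (z • u - T u)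
  rw [hinv, hu, norm_sub_rev] at hle
  have hpos : 0 < ‖(↑w⁻¹ : E →L[ℂ] E)‖ + 1 := by positivity
  rw [← one_div, lt_div_iff₀ hpos] at hlt
  nlinarith [norm_nonneg (T u - z • u)]

theorem IsStarNormal.exists_norm_lt_of_mem_spectrum [InnerProductSpace ℂ E] [CompleteSpace E]
    {T : E →L[ℂ] E} (hT : IsStarNormal T) {z : ℂ} (hz : z ∈ spectrum ℂ T) {ε : ℝ} (hε : 0 < ε) :
    ∃ u, ‖u‖ = 1 ∧ ‖T u - z • u‖ < ε := by
  by_contra! h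
  lift ε to NNReal using hε.le
  refine hz (spectrum.mem_resolventSet_iff.2 ?_)
  set S : E →L[ℂ] E := algebraMap ℂ (E →L[ℂ] E) z - T with hS
  have hSapply (u : E) : S u = z • u - T u := by
    simp [hS, Algebra.algebraMap_eq_smul_one]
  have hSn : IsStarNormal S := by
    refine ⟨?_⟩
    have h1 : Commute (star T) T := hT.star_comm_self
    rw [hS, star_sub, ← algebraMap_star_comm]
    exact ((Algebra.commute_algebraMap_left _ _).sub_right
      (Algebra.commute_algebraMap_left _ _)).sub_left
      ((Algebra.commute_algebraMap_right _ _).sub_right h1)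
  have hbound (u : E) : ε * ‖u‖ ≤ ‖S u‖ := by
    rcases eq_or_ne u 0 with rfl | hu
    · simp
    have hu' : 0 < ‖u‖ := norm_pos_iff.2 hu
    have := h (((‖u‖⁻¹ : ℝ) : ℂ) • u) (by
      rw [norm_smul, Complex.norm_real, norm_inv, norm_norm, inv_mul_cancel₀ hu'.ne'])
    rw [map_smul, smul_comm z, ← smul_sub, norm_smul, Complex.norm_real, norm_inv, norm_norm,
      norm_sub_rev, ← hSapply, ← div_eq_inv_mul, le_div_iff₀ hu'] at this
    exact this
  have hanti : AntilipschitzWith ε⁻¹ S := by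
    refine S.antilipschitz_of_bound fun u => ?_
    rw [NNReal.coe_inv, ← div_eq_inv_mul, le_div_iff₀ hε, mul_comm]
    exact hbound u
  rw [ContinuousLinearMap.isUnit_iff_bijective,
    ContinuousLinearMap.bijective_iff_dense_range_and_antilipschitz]
  refine ⟨?_, _, hanti⟩
  rw [Submodule.topologicalClosure_eq_top_iff, ContinuousLinearMap.IsStarNormal.orthogonal_range hSn]
  exact LinearMap.ker_eq_bot.2 hanti.injective

end ApproximateEigenvectors

section SquareSummable

open scoped lp

variable {α β γ : Type*}

theorem memℓp_two_iff_summable_sq {f : α → ℂ} : Memℓp f 2 ↔ Summable fun i => ‖f i‖ ^ 2 := by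
  simpa using memℓp_gen_iff (p := 2) (f := f) (by norm_num)

theorem lp.hasSum_norm_sq (u : ℓ²(α, ℂ)) : HasSum (fun i => ‖u i‖ ^ 2) (‖u‖ ^ 2) := by
  simpa using lp.hasSum_norm (p := 2) (by norm_num) u

/-- The restriction of a square-summable function to the fibre over `b` of a product
decomposition. -/
def lp.slice (e : β × α ≃ γ) (b : β) : ℓ²(γ, ℂ) →ₗ[ℂ] ℓ²(α, ℂ) where
  toFun u := ⟨fun a => u (e (b, a)), memℓp_two_iff_summable_sq.2
    ((lp.hasSum_norm_sq u).summable.comp_injective (i := fun a => e (b, a))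
      (e.injective.comp (Prod.mk_right_injective b)))⟩
  map_add' _ _ := rfl
  map_smul' _ _ := rfl

theorem lp.hasSum_norm_slice_sq (e : β × α ≃ γ) (u : ℓ²(γ, ℂ)) :
    HasSum (fun b => ‖lp.slice e b u‖ ^ 2) (‖u‖ ^ 2) :=
  ((e.hasSum_iff).2 (lp.hasSum_norm_sq u)).prod_fiberwise
    fun b => lp.hasSum_norm_sq (lp.slice e b u)

theorem lp.summable_norm_apply_slice_sq (e : β × α ≃ γ) (T : ℓ²(α, ℂ) →L[ℂ] ℓ²(α, ℂ))
    (u : ℓ²(γ, ℂ)) : Summable fun b => ‖T (lp.slice e b u)‖ ^ 2 :=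
  .of_nonneg_of_le (fun _ => by positivity)
    (fun b => by
      rw [← mul_pow]
      exact pow_le_pow_left₀ (norm_nonneg _) (T.le_opNorm _) 2)
    ((lp.hasSum_norm_slice_sq e u).summable.mul_left (‖T‖ ^ 2))

theorem lp.memℓp_apply_slice (e : β × α ≃ γ) (T : ℓ²(α, ℂ) →L[ℂ] ℓ²(α, ℂ)) (u : ℓ²(γ, ℂ)) :
    Memℓp (fun c => T (lp.slice e (e.symm c).1 u) (e.symm c).2) 2 := by
  rw [memℓp_two_iff_summable_sq, ← e.summable_iff]
  refine (summable_prod_of_nonneg fun _ => sq_nonneg _).2 ⟨fun b => ?_, ?_⟩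
  · simpa using (lp.hasSum_norm_sq (T (lp.slice e b u))).summable
  · simpa [(lp.hasSum_norm_sq _).tsum_eq] using lp.summable_norm_apply_slice_sq e T u

/-- The operator on `ℓ²(γ)` that acts as `T` on each fibre of a product decomposition. -/
noncomputable def lp.ampliation (e : β × α ≃ γ) (T : ℓ²(α, ℂ) →L[ℂ] ℓ²(α, ℂ)) :
    ℓ²(γ, ℂ) →L[ℂ] ℓ²(γ, ℂ) :=
  LinearMap.mkContinuous
    { toFun := fun u => ⟨_, lp.memℓp_apply_slice e T u⟩
      map_add' := fun u w => by
        ext c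
        simp only [map_add]
        rfl
      map_smul' := fun z u => by
        ext c
        simp only [map_smul]
        rfl } ‖T‖ fun u => by
    refine le_of_sq_le_sq ?_ (by positivity)
    rw [mul_pow]
    refine hasSum_le (f := fun b => ‖T (lp.slice e b u)‖ ^ 2) (fun b => ?_)
      (((e.hasSum_iff).2 (lp.hasSum_norm_sq _)).prod_fiberwise fun b => ?_)
      ((lp.hasSum_norm_slice_sq e u).mul_left (‖T‖ ^ 2))
    · rw [← mul_pow]
      exact pow_le_pow_left₀ (norm_nonneg _) (T.le_opNorm _) 2
    · simpa using lp.hasSum_norm_sq (T (lp.slice e b u))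

theorem lp.ampliation_apply (e : β × α ≃ γ) (T : ℓ²(α, ℂ) →L[ℂ] ℓ²(α, ℂ)) (u : ℓ²(γ, ℂ)) (c : γ) :
    lp.ampliation e T u c = T (lp.slice e (e.symm c).1 u) (e.symm c).2 :=
  rfl

theorem lp.slice_ampliation (e : β × α ≃ γ) (T : ℓ²(α, ℂ) →L[ℂ] ℓ²(α, ℂ)) (b : β)
    (u : ℓ²(γ, ℂ)) : lp.slice e b (lp.ampliation e T u) = T (lp.slice e b u) := by
  ext a
  change lp.ampliation e T u (e (b, a)) = _
  rw [lp.ampliation_apply, e.symm_apply_apply]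

/-- `lp.ampliation` as a homomorphism of algebras. -/
noncomputable def lp.ampliationHom (e : β × α ≃ γ) :
    (ℓ²(α, ℂ) →L[ℂ] ℓ²(α, ℂ)) →ₐ[ℂ] (ℓ²(γ, ℂ) →L[ℂ] ℓ²(γ, ℂ)) :=
  AlgHom.ofLinearMap
    { toFun := lp.ampliation e
      map_add' := fun _ _ => rfl
      map_smul' := fun _ _ => rfl }
    (by
      ext u c
      change u (e (e.symm c)) = u c
      rw [e.apply_symm_apply])
    (fun S T => by
      ext u c
      exact congrArg (fun w : ℓ²(α, ℂ) => S w (e.symm c).2) (lp.slice_ampliation e T _ u).symm)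

theorem HasSum.prod_fin_of_nonneg {d : ℕ} {f : Fin d → α → ℝ} {s : Fin d → ℝ}
    (hf : ∀ j a, 0 ≤ f j a) (h : ∀ j, HasSum (f j) (s j)) :
    HasSum (fun n : Fin d → α => ∏ j, f j (n j)) (∏ j, s j) := by
  induction d with
  | zero => simp
  | succ d ih =>
    have htail : HasSum (fun n : Fin d → α => ∏ j, f j.succ (n j)) (∏ j : Fin d, s j.succ) :=
      ih (f := fun j => f j.succ) (s := fun j => s j.succ) (fun j => hf j.succ) fun j => h j.succ
    have htail_nonneg : 0 ≤ fun n : Fin d → α => ∏ j, f j.succ (n j) :=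
      fun n => Finset.prod_nonneg fun j _ => hf j.succ (n j)
    have hprod := Summable.mul_of_nonneg (h 0).summable htail.summable (hf 0) htail_nonneg
    rw [← (Fin.consEquiv fun _ : Fin (d + 1) => α).hasSum_iff, Fin.prod_univ_succ]
    refine ((h 0).mul htail hprod).congr_fun fun x => ?_
    rw [Function.comp_apply, Fin.prod_univ_succ]
    rfl

/-- The product vector `n ↦ ∏ j, u j (n j)`. -/
noncomputable def lp.pureTensor {d : ℕ} (u : Fin d → ℓ²(α, ℂ)) : ℓ²(Fin d → α, ℂ) :=
  ⟨fun n => ∏ j, u j (n j), memℓp_two_iff_summable_sq.2 <| by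
    simpa [Finset.prod_pow] using (HasSum.prod_fin_of_nonneg (fun j a => by positivity)
      fun j => lp.hasSum_norm_sq (u j)).summable⟩

theorem lp.norm_pureTensor {d : ℕ} (u : Fin d → ℓ²(α, ℂ)) :
    ‖lp.pureTensor u‖ = ∏ j, ‖u j‖ := by
  refine (sq_eq_sq₀ (norm_nonneg _) (by positivity)).1 ((lp.hasSum_norm_sq _).unique ?_)
  simpa [lp.pureTensor, Finset.prod_pow] using HasSum.prod_fin_of_nonneg
    (fun j a => by positivity) fun j => lp.hasSum_norm_sq (u j)

/-- The splitting of the coordinate `j` from the other coordinates. -/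
def Equiv.coordSplit {ι : Type*} [DecidableEq ι] (α : Type*) (j : ι) :
    ({k // k ≠ j} → α) × α ≃ (ι → α) :=
  (Equiv.prodComm _ _).trans (Equiv.funSplitAt j α).symm

@[simp]
theorem Equiv.coordSplit_symm_snd {ι : Type*} [DecidableEq ι] (j : ι) (n : ι → α) :
    ((Equiv.coordSplit α j).symm n).2 = n j :=
  rfl

@[simp]
theorem Equiv.coordSplit_apply_symm_fst {ι : Type*} [DecidableEq ι] (j : ι) (n : ι → α) (m : α) :
    Equiv.coordSplit α j (((Equiv.coordSplit α j).symm n).1, m) = Function.update n j m := by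
  ext k
  by_cases h : k = j
  · subst h
    simp [Equiv.coordSplit]
  · simp [Equiv.coordSplit, h]

theorem lp.slice_coordSplit_apply {ι : Type*} [DecidableEq ι] (j : ι) (n : ι → α)
    (u : ℓ²(ι → α, ℂ)) (m : α) :
    lp.slice (Equiv.coordSplit α j) ((Equiv.coordSplit α j).symm n).1 u m =
      u (Function.update n j m) := by
  change u (Equiv.coordSplit α j _) = _
  rw [Equiv.coordSplit_apply_symm_fst]

theorem lp.ampliation_pureTensor {d : ℕ} (j : Fin d) (T : ℓ²(α, ℂ) →L[ℂ] ℓ²(α, ℂ))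
    (u : Fin d → ℓ²(α, ℂ)) :
    lp.ampliation (Equiv.coordSplit α j) T (lp.pureTensor u) =
      lp.pureTensor (Function.update u j (T (u j))) := by
  ext n
  have hslice : lp.slice (Equiv.coordSplit α j) ((Equiv.coordSplit α j).symm n).1
      (lp.pureTensor u) = (∏ k ∈ Finset.univ.erase j, u k (n k)) • u j := by
    ext m
    rw [lp.slice_coordSplit_apply]
    change ∏ k, u k (Function.update n j m k) = _ * u j m
    rw [← Finset.prod_erase_mul _ _ (Finset.mem_univ j), Function.update_self]
    congr 1
    refine Finset.prod_congr rfl fun k hk => ?_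
    rw [Function.update_of_ne (Finset.ne_of_mem_erase hk)]
  rw [lp.ampliation_apply, hslice, map_smul, Equiv.coordSplit_symm_snd]
  change _ * T (u j) (n j) = ∏ k, Function.update u j (T (u j)) k (n k)
  rw [← Finset.prod_erase_mul _ _ (Finset.mem_univ j), Function.update_self]
  congr 1
  refine Finset.prod_congr rfl fun k hk => ?_
  rw [Function.update_of_ne (Finset.ne_of_mem_erase hk)]

theorem lp.norm_ampliation_pureTensor_sub {d : ℕ} (j : Fin d) (T : ℓ²(α, ℂ) →L[ℂ] ℓ²(α, ℂ))
    (z : ℂ) {u : Fin d → ℓ²(α, ℂ)} (hu : ∀ k, ‖u k‖ = 1) :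
    ‖lp.ampliation (Equiv.coordSplit α j) T (lp.pureTensor u) - z • lp.pureTensor u‖ =
      ‖T (u j) - z • u j‖ := by
  have key := lp.ampliation_pureTensor j (T - algebraMap ℂ _ z) u
  have h1 : lp.ampliation (Equiv.coordSplit α j) (T - algebraMap ℂ _ z) =
      lp.ampliation (Equiv.coordSplit α j) T - algebraMap ℂ _ z := by
    change lp.ampliationHom _ (T - algebraMap ℂ _ z) = lp.ampliationHom _ T - _
    rw [map_sub, AlgHom.commutes]
  rw [h1] at key
  simp only [Algebra.algebraMap_eq_smul_one, sub_apply, smul_apply,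
    one_apply_eq_self] at key
  rw [key, lp.norm_pureTensor, ← Finset.prod_erase_mul _ _ (Finset.mem_univ j),
    Function.update_self, Finset.prod_eq_one fun k hk => ?_, one_mul]
  rw [Function.update_of_ne (Finset.ne_of_mem_erase hk), hu]

end SquareSummable

section DiscreteSchrodinger

open scoped lp

theorem isSelfAdjoint_discreteSchrodinger {v : ℤ → ℝ} {T : ℓ²(ℤ, ℂ) →L[ℂ] ℓ²(ℤ, ℂ)}
    (hT : ∀ (u : ℓ²(ℤ, ℂ)) (n : ℤ), T u n = u (n + 1) + u (n - 1) + (v n : ℂ) * u n) :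
    IsSelfAdjoint T := by
  have hmem (u : ℓ²(ℤ, ℂ)) (k : ℤ) : Memℓp (fun n => u (n + k)) 2 :=
    memℓp_two_iff_summable_sq.2
      ((lp.hasSum_norm_sq u).summable.comp_injective (add_left_injective k))
  let shift (k : ℤ) (u : ℓ²(ℤ, ℂ)) : ℓ²(ℤ, ℂ) := ⟨fun n => u (n + k), hmem u k⟩
  have hshift (k : ℤ) (x y : ℓ²(ℤ, ℂ)) : inner ℂ (shift k x) y = inner ℂ x (shift (-k) y) := by
    rw [lp.inner_eq_tsum, lp.inner_eq_tsum, ← (Equiv.addRight (-k)).tsum_eq]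
    refine tsum_congr fun n => ?_
    simp [shift]
  have hmul (u : ℓ²(ℤ, ℂ)) : ((T u - shift 1 u - shift (-1) u : ℓ²(ℤ, ℂ)) : ℤ → ℂ) =
      fun n => (v n : ℂ) * u n := by
    ext n
    change T u n - u (n + 1) - u (n + -1) = _
    rw [hT, ← sub_eq_add_neg]
    ring
  have hmul_inner (x y : ℓ²(ℤ, ℂ)) : inner ℂ (T x - shift 1 x - shift (-1) x) y =
      inner ℂ x (T y - shift 1 y - shift (-1) y) := by
    rw [lp.inner_eq_tsum, lp.inner_eq_tsum]
    refine tsum_congr fun n => ?_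
    rw [hmul, hmul]
    simp only [RCLike.inner_apply, map_mul, Complex.conj_ofReal]
    ring
  rw [ContinuousLinearMap.isSelfAdjoint_iff_isSymmetric]
  intro x y
  have := hmul_inner x y
  simp only [inner_sub_left, inner_sub_right, hshift, neg_neg] at this
  change inner ℂ (T x) y = inner ℂ x (T y)
  linear_combination this

end DiscreteSchrodinger

/-- Spectrum of separable discrete Schrödinger operators:
`σ(H) = σ(H₁) + ⋯ + σ(H_d)`. -/
theorem spectrum_separable_operator (d : ℕ) (hd : 1 ≤ d) (v : Fin d → ℤ → ℝ)
    (hv : ∀ j, ∃ C : ℝ, ∀ n : ℤ, |v j n| ≤ C)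
    (H : lp (fun _ : Fin d → ℤ => ℂ) 2 →L[ℂ] lp (fun _ : Fin d → ℤ => ℂ) 2)
    (Hj : Fin d → (lp (fun _ : ℤ => ℂ) 2 →L[ℂ] lp (fun _ : ℤ => ℂ) 2))
    (hH : ∀ (u : lp (fun _ : Fin d → ℤ => ℂ) 2) (n : Fin d → ℤ),
        H u n = (∑ i : Fin d, (u (n + Pi.single i 1) + u (n - Pi.single i 1)))
          + ((∑ j, v j (n j) : ℝ) : ℂ) * u n)
    (hHj : ∀ (j : Fin d) (u : lp (fun _ : ℤ => ℂ) 2) (n : ℤ),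
        Hj j u n = u (n + 1) + u (n - 1) + (v j n : ℂ) * u n) :
    spectrum ℂ H
      = {x : ℂ | ∃ E : Fin d → ℂ, (∀ j, E j ∈ spectrum ℂ (Hj j)) ∧ x = ∑ j, E j} := by
  let A (j : Fin d) := lp.ampliation (Equiv.coordSplit ℤ j) (Hj j)
  have hA (j : Fin d) (u : lp (fun _ : Fin d → ℤ => ℂ) 2) (n : Fin d → ℤ) :
      A j u n = u (n + Pi.single j 1) + u (n - Pi.single j 1) + (v j (n j) : ℂ) * u n := by
    have hupd (k : ℤ) : Function.update n j (n j + k) = n + Pi.single j k := by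
      ext i
      by_cases h : i = j
      · subst h
        simp
      · simp [h]
    rw [lp.ampliation_apply, hHj]
    simp only [lp.slice_coordSplit_apply, Equiv.coordSplit_symm_snd, sub_eq_add_neg, hupd,
      Function.update_eq_self, Pi.single_neg]
  have hsum : H = ∑ j, A j := by
    ext u n
    rw [hH, sum_apply, lp.coeFn_sum, Finset.sum_apply]
    simp only [hA]
    rw [Complex.ofReal_sum, Finset.sum_mul, ← Finset.sum_add_distrib]
  have hcomm (i j : Fin d) : Commute (A i) (A j) := by
    rcases eq_or_ne i j with rfl | hij
    · exact Commute.refl _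
    ext u n
    change A i (A j u) n = A j (A i u) n
    simp only [hA, Pi.add_apply, Pi.sub_apply, Pi.single_eq_of_ne hij, Pi.single_eq_of_ne hij.symm,
      add_zero, sub_eq_add_neg, add_right_comm n, neg_zero]
    ring
  ext x
  constructor
  · intro hx
    rw [hsum] at hx
    obtain ⟨E, hE, rfl⟩ := spectrum.exists_eq_sum_of_mem_sum_of_commute hcomm hx
    exact ⟨E, fun j => AlgHom.spectrum_apply_subset
      (lp.ampliationHom (Equiv.coordSplit ℤ j)) (Hj j) (hE j), rfl⟩
  · rintro ⟨E, hE, rfl⟩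
    refine ContinuousLinearMap.mem_spectrum_of_forall_exists_norm_lt fun ε hε => ?_
    have hd' : (0 : ℝ) < d := by exact_mod_cast hd
    choose u hu hlt using fun j =>
      (isSelfAdjoint_discreteSchrodinger (hHj j)).isStarNormal.exists_norm_lt_of_mem_spectrum (hE j)
        (div_pos hε hd')
    refine ⟨lp.pureTensor u, by simp [lp.norm_pureTensor, hu], ?_⟩
    rw [hsum, sum_apply, Finset.sum_smul, ← Finset.sum_sub_distrib]
    calc ‖∑ j, (A j (lp.pureTensor u) - E j • lp.pureTensor u)‖
        ≤ ∑ j, ‖Hj j (u j) - E j • u j‖ :=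
          norm_sum_le_of_le _ fun j _ => (lp.norm_ampliation_pureTensor_sub j (Hj j) (E j) hu).le
      _ < ∑ _j : Fin d, ε / d :=
          Finset.sum_lt_sum_of_nonempty ⟨⟨0, hd⟩, Finset.mem_univ _⟩ fun j _ => hlt j
      _ = ε := by
          rw [Finset.sum_const, Finset.card_univ, Fintype.card_fin, nsmul_eq_mul]
          field_simp
end
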